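/- Let l be a positive integer and let m be an integer with 2^(2l+1) ≤ m ≤ 2^(2l+2) − 3. Then there do not exist sets C, D ⊆ ℕ with C ∪ D = ℕ, 0 ∈ C, and C ∩ D = ((2^(2l+1) − 2) + mℕ) ∪ ((2^(2l+1) − 1) + mℕ) such that R_C(n) = R_D(n) for all n ∈ ℕ. -/

import Mathlib

/-- `R S n` is the number of pairs `(s, s')` with `s, s' ∈ S`, `s < s'` and `s + s' = n`. -/
noncomputable def R (S : Set ℕ) (n : ℕ) : ℕ :=
  Set.ncard {p : ℕ × ℕ | p.1 ∈ S ∧ p.2 ∈ S ∧ p.1 < p.2 ∧ p.1 + p.2 = n}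

/-- `AP r m` is the arithmetic progression `r + mℕ = {r + m*k : k ∈ ℕ}`. -/
def AP (r m : ℕ) : Set ℕ := {n | ∃ k : ℕ, n = r + m * k}

/-- The signed Thue–Morse sequence. -/
def thueMorse (n : ℕ) : ℤ :=
  if _h : n = 0 then 1
  else if n % 2 = 0 then thueMorse (n / 2) else -thueMorse (n / 2)
termination_by n
decreasing_by all_goals omega

theorem thueMorse_zero : thueMorse 0 = 1 := by
  rw [thueMorse]; simp

theorem thueMorse_two_mul (n : ℕ) : thueMorse (2 * n) = thueMorse n := by
  rcases Nat.eq_zero_or_pos n with rfl | h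
  · rfl
  · rw [thueMorse, dif_neg (by omega), if_pos (by omega)]
    congr 1; omega

theorem thueMorse_two_mul_add_one (n : ℕ) : thueMorse (2 * n + 1) = -thueMorse n := by
  rw [thueMorse, dif_neg (by omega), if_neg (by omega)]
  congr 2; omega

theorem thueMorse_eq_one_or (n : ℕ) : thueMorse n = 1 ∨ thueMorse n = -1 := by
  induction n using Nat.strong_induction_on with
  | _ n ih =>
    obtain ⟨k, rfl | rfl⟩ := Nat.even_or_odd' n
    · rcases Nat.eq_zero_or_pos k with rfl | h
      · exact Or.inl thueMorse_zero
      · rw [thueMorse_two_mul]; exact ih k (by omega)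
    · rw [thueMorse_two_mul_add_one]
      rcases ih k (by omega) with h | h <;> simp [h]

theorem thueMorse_two_pow_add (a j : ℕ) (h : j < 2 ^ a) :
    thueMorse (2 ^ a + j) = -thueMorse j := by
  induction a generalizing j with
  | zero =>
    obtain rfl : j = 0 := by simpa using h
    exact thueMorse_two_mul_add_one 0
  | succ a ih =>
    rw [pow_succ] at h ⊢
    obtain ⟨k, rfl | rfl⟩ := Nat.even_or_odd' j
    · rw [show 2 ^ a * 2 + 2 * k = 2 * (2 ^ a + k) by ring, thueMorse_two_mul,
        thueMorse_two_mul, ih k (by omega)]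
    · rw [show 2 ^ a * 2 + (2 * k + 1) = 2 * (2 ^ a + k) + 1 by ring,
        thueMorse_two_mul_add_one, thueMorse_two_mul_add_one, ih k (by omega)]

/-- Complementing the binary digits of `i` among `a` digits. -/
theorem thueMorse_complement (a i j : ℕ) (h : i + j + 1 = 2 ^ a) :
    thueMorse i = (-1) ^ a * thueMorse j := by
  induction a generalizing i j with
  | zero =>
    obtain ⟨rfl, rfl⟩ : i = 0 ∧ j = 0 := by simpa using h
    simp
  | succ a ih =>
    rw [pow_succ] at h ⊢
    obtain ⟨x, rfl | rfl⟩ := Nat.even_or_odd' i <;> obtain ⟨y, rfl | rfl⟩ := Nat.even_or_odd' j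
    · omega
    · rw [thueMorse_two_mul, thueMorse_two_mul_add_one, ih x y (by omega)]; ring
    · rw [thueMorse_two_mul, thueMorse_two_mul_add_one, ih x y (by omega)]; ring
    · omega

/-- The coefficients of `(1 - x) f(x²)`, where `f` is the generating function of the sequence. -/
def dilate (f : ℕ → ℤ) (n : ℕ) : ℤ := if n % 2 = 0 then f (n / 2) else -f (n / 2)

theorem dilate_eq (f : ℕ → ℤ) (n : ℕ) (h : f (n / 2) = thueMorse (n / 2)) :
    dilate f n = thueMorse n := by
  obtain ⟨k, hk⟩ := Nat.even_or_odd' n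
  rcases hk with rfl | rfl
  · rw [show 2 * k / 2 = k by omega] at h
    rw [dilate, if_pos (by omega), thueMorse_two_mul, show 2 * k / 2 = k by omega, h]
  · rw [show (2 * k + 1) / 2 = k by omega] at h
    rw [dilate, if_neg (by omega), thueMorse_two_mul_add_one,
      show (2 * k + 1) / 2 = k by omega, h]

theorem dilate_two_mul_add (f : ℕ → ℤ) (q i s : ℕ)
    (h : f (q + i / 2) = -thueMorse (i / 2 + s)) :
    dilate f (2 * q + i) = -thueMorse (i + 2 * s) := by
  obtain ⟨k, hk⟩ := Nat.even_or_odd' i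
  rcases hk with rfl | rfl
  · rw [show 2 * k / 2 = k by omega] at h
    rw [dilate, if_pos (by omega), show 2 * k + 2 * s = 2 * (k + s) by ring, thueMorse_two_mul,
      show (2 * q + 2 * k) / 2 = q + k by omega, h]
  · rw [show (2 * k + 1) / 2 = k by omega] at h
    rw [dilate, if_neg (by omega), show 2 * k + 1 + 2 * s = 2 * (k + s) + 1 by ring,
      thueMorse_two_mul_add_one, show (2 * q + (2 * k + 1)) / 2 = q + k by omega, h]

/-- The recurrence of the sequence `1_C - 1_D` has no solution with the prescribed zeros. -/
theorem recurrence_false (f : ℕ → ℤ) (l p j : ℕ) (hl : 0 < l) (hp : p + 2 = 2 ^ (2 * l + 1))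
    (hj : j + 1 ≤ p) (hf0 : f 0 = 1) (hp0 : f p = 0) (hp1 : f (p + 1) = 0)
    (hf : ∀ n, f n = 1 ∨ f n = 0 ∨ f n = -1)
    (hlow : ∀ n, 0 < n → n < p → f n = dilate f n)
    (hmid : ∀ i, i < p + j → f (p + 2 + i) = dilate f (p + 2 + i) - f (i + 2) + f i)
    (hz0 : dilate f (2 * (p + 1) + j) - f (p + 2 + j) + f (p + j) - f 0 = 0)
    (hz1 : dilate f (2 * (p + 1) + (j + 1)) - f (p + 2 + (j + 1)) + f (p + 1 + j) - f 1 = 0)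
    (hhigh : ∀ k, k < p + j → f (2 * (p + 2) + (j + k)) = dilate f (2 * (p + 2) + (j + k))
      - f (p + 2 + (j + k + 2)) + f (p + 2 + (j + k)) - f (k + 2) + f k) : False := by
  have hp6 : 6 ≤ p := by
    have : 2 ^ 3 ≤ 2 ^ (2 * l + 1) := Nat.pow_le_pow_right (by norm_num) (by omega)
    omega
  have hpe : p % 2 = 0 := by
    rw [pow_succ] at hp; omega
  have hcompl (x y : ℕ) (h : x + y = p + 1) : thueMorse x = -thueMorse y := by
    rw [thueMorse_complement (2 * l + 1) x y (by omega), pow_succ, pow_mul]; simp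
  have T0 := thueMorse_zero
  have T1 : thueMorse 1 = -1 := by rw [← T0]; exact thueMorse_two_mul_add_one 0
  have T2 : thueMorse 2 = -1 := by rw [← T1]; exact thueMorse_two_mul 1
  have T3 : thueMorse 3 = 1 := by rw [thueMorse_two_mul_add_one 1, T1]; rfl
  have T4 : thueMorse 4 = -1 := by rw [← T2]; exact thueMorse_two_mul 2
  have low (n : ℕ) (hn : n < p) : f n = thueMorse n := by
    induction n using Nat.strong_induction_on with
    | _ n ih =>
      rcases Nat.eq_zero_or_pos n with rfl | h
      · rw [hf0, T0]
      · rw [hlow n h hn]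
        exact dilate_eq f n (ih _ (by omega) (by omega))
  have mid (i : ℕ) (hi : i < p) : f (p + 2 + i) = -thueMorse (i + 2) := by
    rw [hmid i (by omega), low i hi]
    rcases lt_or_ge (i + 2) p with h | h
    · rw [dilate_eq f _ (low _ (by omega)), low _ h, hp, thueMorse_two_pow_add _ _ (by omega)]
      ring
    · obtain rfl | rfl : i + 2 = p ∨ i = p - 1 := by omega
      · rw [dilate, if_pos (by omega), show (i + 2 + 2 + i) / 2 = i + 2 by omega, hp0,
          hcompl i 3 (by omega), hcompl (i + 2) 1 (by omega), T3, T1]; rfl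
      · rw [dilate, if_neg (by omega), show (p + 2 + (p - 1)) / 2 = p by omega, hp0,
          show p - 1 + 2 = p + 1 by omega, hp1, hcompl (p - 1) 2 (by omega),
          hcompl (p + 1) 0 (by omega), T2, T0]; rfl
  have f1 : f 1 = -1 := by rw [low 1 (by omega), T1]
  rcases Nat.eq_zero_or_pos j with rfl | hj0
  · rw [mid 0 (by omega), show p + 0 = p from rfl, hp0, hf0, T2] at hz0
    rw [dilate, if_pos (by omega), show (2 * (p + 1) + 0) / 2 = p + 1 by omega, hp1] at hz0
    omega
  obtain rfl | hj2 : j = 1 ∨ 2 ≤ j := by omega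
  · rw [mid _ (by omega), f1, dilate, if_pos (by omega),
      show (2 * (p + 1) + (1 + 1)) / 2 = p + 2 + 0 by omega, mid 0 (by omega), T4, T2] at hz1
    omega
  have tj : thueMorse j = -1 := by
    obtain ⟨x, rfl⟩ : ∃ x, j = x + 2 := ⟨j - 2, by omega⟩
    have e : dilate f (2 * (p + 1) + (x + 2)) = -thueMorse (x + 2 + 2) := by
      rw [show 2 * (p + 1) + (x + 2) = 2 * (p + 2) + x by ring]
      exact dilate_two_mul_add f (p + 2) x 2 (mid _ (by omega)) |>.trans (by ring_nf)
    rw [e, mid _ (by omega), show p + (x + 2) = p + 2 + x by ring, mid _ (by omega), hf0] at hz0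
    omega
  have hjp : j + 2 ≤ p := by
    by_contra h
    have := hcompl j 2 (by omega)
    omega
  have high (k : ℕ) (hk : j + k ≤ p) : dilate f (2 * (p + 2) + (j + k))
      = -thueMorse (j + k + 4) :=
    dilate_two_mul_add f (p + 2) (j + k) 2 (mid _ (by omega))
  have next (h : j + 2 < p) : thueMorse (j + 2) = 1 := by
    have h0 := hhigh 0 (by omega)
    rw [high 0 (by omega), mid _ (by omega), mid _ (by omega), low (0 + 2) (by omega), hf0, zero_add,
      T2, show j + 0 + 2 + 2 = j + 0 + 4 from rfl] at h0
    simp only [add_zero] at h0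
    rcases thueMorse_eq_one_or (j + 2) with h' | h'
    · exact h'
    · have := hf (2 * (p + 2) + j)
      rw [h'] at h0
      omega
  obtain ⟨i, rfl | rfl⟩ := Nat.even_or_odd' j
  · obtain ⟨k, hk⟩ : ∃ k, 2 * i + k + 2 = p := ⟨p - 2 - 2 * i, by omega⟩
    have ek : k % 2 = 0 := by omega
    obtain ⟨s, rfl⟩ : ∃ s, k = 2 * s := ⟨k / 2, by omega⟩
    have tk2 : thueMorse (2 * s + 2) = -1 := by
      have := hcompl (2 * s + 2) (2 * i + 1) (by omega)
      rw [thueMorse_two_mul_add_one] at this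
      rw [thueMorse_two_mul] at tj
      omega
    have tk : thueMorse (2 * s) = 1 := by
      rcases Nat.eq_zero_or_pos s with rfl | hs
      · exact T0
      · have h1 := next (by omega)
        have := hcompl (2 * s) (2 * (i + 1) + 1) (by omega)
        rw [thueMorse_two_mul_add_one] at this
        rw [show 2 * i + 2 = 2 * (i + 1) by ring, thueMorse_two_mul] at h1
        omega
    have tq : thueMorse (p + 2) = -1 := by
      rw [hp, ← add_zero (2 ^ _), thueMorse_two_pow_add _ _ (by positivity), T0]
    have hend : f (p + 2 + p) = -1 := by
      rw [hmid p (by omega), dilate, if_pos (by omega), show (p + 2 + p) / 2 = p + 1 by omega,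
        hp1, hp0, mid 0 (by omega), T2]; rfl
    have h0 := hhigh (2 * s) (by omega)
    rw [high _ (by omega), hk, hend, mid _ (by omega), low (2 * s + 2) (by omega),
      low (2 * s) (by omega),
      tk2, tk, hk, hcompl p 1 (by omega), T1, show 2 * i + 2 * s + 4 = p + 2 by omega, tq] at h0
    have := hf (2 * (p + 2) + (2 * i + 2 * s))
    omega
  · have h2 := next (by omega)
    rw [show 2 * i + 1 + 2 = 2 * (i + 1) + 1 by ring, thueMorse_two_mul_add_one] at h2
    have e : dilate f (2 * (p + 1) + (2 * i + 1 + 1)) = -thueMorse (2 * (i + 2)) := by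
      rw [show 2 * (p + 1) + (2 * i + 1 + 1) = 2 * (p + 2) + 2 * i by ring]
      exact dilate_two_mul_add f (p + 2) (2 * i) 2 (mid _ (by omega)) |>.trans (by ring_nf)
    rw [e, mid _ (by omega), show p + 1 + (2 * i + 1) = p + 2 + 2 * i by ring,
      mid _ (by omega), f1, show 2 * i + 1 + 1 + 2 = 2 * (i + 2) by ring,
      show 2 * i + 2 = 2 * (i + 1) by ring, thueMorse_two_mul (i + 1)] at hz1
    omega

open Classical in
theorem two_mul_R_add (S : Set ℕ) (n : ℕ) :
    2 * (R S n : ℤ) + (if n % 2 = 0 then S.indicator 1 (n / 2) else 0) =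
      ∑ p ∈ Finset.HasAntidiagonal.antidiagonal n, S.indicator (1 : ℕ → ℤ) p.1 * S.indicator 1 p.2 := by
  have hR : (R S n : ℤ) = ∑ p ∈ Finset.HasAntidiagonal.antidiagonal n,
      if p.1 < p.2 then S.indicator (1 : ℕ → ℤ) p.1 * S.indicator 1 p.2 else 0 := by
    have : {p : ℕ × ℕ | p.1 ∈ S ∧ p.2 ∈ S ∧ p.1 < p.2 ∧ p.1 + p.2 = n} =
        ((Finset.HasAntidiagonal.antidiagonal n).filter fun p => p.1 ∈ S ∧ p.2 ∈ S ∧ p.1 < p.2 :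
          Finset (ℕ × ℕ)) := by
      ext p; simp; tauto
    rw [R, this, Set.ncard_coe_finset, Finset.card_filter, Nat.cast_sum]
    refine Finset.sum_congr rfl fun p _ => ?_
    by_cases h1 : p.1 ∈ S <;> by_cases h2 : p.2 ∈ S <;> simp [h1, h2]
  have hR' : (R S n : ℤ) = ∑ p ∈ Finset.HasAntidiagonal.antidiagonal n,
      if p.2 < p.1 then S.indicator (1 : ℕ → ℤ) p.1 * S.indicator 1 p.2 else 0 := by
    rw [hR, ← Finset.Nat.sum_antidiagonal_swap]
    exact Finset.sum_congr rfl fun p _ => by simp [mul_comm]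
  have hdiag : (if n % 2 = 0 then S.indicator (1 : ℕ → ℤ) (n / 2) else 0) =
      ∑ p ∈ Finset.HasAntidiagonal.antidiagonal n,
        if p.1 = p.2 then S.indicator (1 : ℕ → ℤ) p.1 * S.indicator 1 p.2 else 0 := by
    split_ifs with h
    · rw [Finset.sum_eq_single (n / 2, n / 2)]
      · by_cases h1 : n / 2 ∈ S <;> simp [h1]
      · rintro ⟨a, b⟩ hab hne
        simp only [Finset.HasAntidiagonal.mem_antidiagonal] at hab
        refine if_neg fun h' : a = b => hne ?_
        ext <;> simp only <;> omega
      · intro h'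
        simp only [Finset.HasAntidiagonal.mem_antidiagonal] at h'
        omega
    · refine (Finset.sum_eq_zero fun p hp => if_neg fun h' => ?_).symm
      rw [Finset.HasAntidiagonal.mem_antidiagonal] at hp
      omega
  rw [two_mul, hdiag]
  nth_rw 2 [hR']
  rw [hR, ← Finset.sum_add_distrib, ← Finset.sum_add_distrib]
  refine Finset.sum_congr rfl fun p _ => ?_
  rcases lt_trichotomy p.1 p.2 with h | h | h
  · simp [h, h.ne, h.not_gt]
  · simp [h]
  · simp [h, h.ne', h.not_gt]

/-- The generating function identity `(C - D)(x) (C + D)(x) = (C - D)(x²)`. -/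
theorem sum_antidiagonal_sub_mul_add (C D : Set ℕ) (n : ℕ) (h : R C n = R D n) :
    ∑ p ∈ Finset.HasAntidiagonal.antidiagonal n, (C.indicator (1 : ℕ → ℤ) p.1 - D.indicator 1 p.1) *
        (C.indicator 1 p.2 + D.indicator 1 p.2) =
      if n % 2 = 0 then C.indicator 1 (n / 2) - D.indicator 1 (n / 2) else 0 := by
  have hC := two_mul_R_add C n
  have hD := two_mul_R_add D n
  have hsymm : ∑ p ∈ Finset.HasAntidiagonal.antidiagonal n, C.indicator (1 : ℕ → ℤ) p.1 * D.indicator 1 p.2 =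
      ∑ p ∈ Finset.HasAntidiagonal.antidiagonal n, D.indicator (1 : ℕ → ℤ) p.1 * C.indicator 1 p.2 := by
    rw [← Finset.Nat.sum_antidiagonal_swap]
    exact Finset.sum_congr rfl fun p _ => by simp [mul_comm]
  simp only [sub_mul, mul_add, Finset.sum_sub_distrib, Finset.sum_add_distrib]
  rw [hsymm, ← hC, ← hD, h]
  split_ifs <;> ring

theorem sum_antidiagonal_mul_ite (f : ℕ → ℤ) (n a : ℕ) :
    ∑ p ∈ Finset.HasAntidiagonal.antidiagonal n, f p.1 * (if p.2 = a then 1 else 0) =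
      if a ≤ n then f (n - a) else 0 := by
  split_ifs with h
  · rw [Finset.sum_eq_single (n - a, a)]
    · simp
    · rintro ⟨x, y⟩ hxy hne
      simp only [Finset.HasAntidiagonal.mem_antidiagonal] at hxy
      have : y ≠ a := fun h' => hne (by ext <;> simp only <;> omega)
      simp [this]
    · intro h'
      simp only [Finset.HasAntidiagonal.mem_antidiagonal] at h'
      omega
  · refine Finset.sum_eq_zero fun p hp => ?_
    rw [Finset.HasAntidiagonal.mem_antidiagonal] at hp
    rw [if_neg (by omega), mul_zero]

theorem stmt_14 (l : ℕ) (hl : 0 < l) (m : ℕ) (hm1 : 2 ^ (2 * l + 1) ≤ m)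
    (hm2 : m ≤ 2 ^ (2 * l + 2) - 3) :
    ¬ ∃ C D : Set ℕ, C ∪ D = Set.univ ∧ 0 ∈ C ∧
      C ∩ D = AP (2 ^ (2 * l + 1) - 2) m ∪ AP (2 ^ (2 * l + 1) - 1) m ∧
      ∀ n : ℕ, R C n = R D n := by
  classical
  rintro ⟨C, D, hU, h0, hI, hR⟩
  obtain ⟨p, hp⟩ : ∃ p, p + 2 = 2 ^ (2 * l + 1) := by
    have : 2 ^ 1 ≤ 2 ^ (2 * l + 1) := Nat.pow_le_pow_right (by norm_num) (by omega)
    exact ⟨2 ^ (2 * l + 1) - 2, by omega⟩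
  have hp6 : 6 ≤ p := by
    have : 2 ^ 3 ≤ 2 ^ (2 * l + 1) := Nat.pow_le_pow_right (by norm_num) (by omega)
    omega
  rw [show 2 * l + 2 = 2 * l + 1 + 1 from rfl, pow_succ, ← hp] at hm2
  rw [← hp] at hm1 hI
  rw [show p + 2 - 2 = p by omega, show p + 2 - 1 = p + 1 by omega] at hI
  obtain ⟨j, rfl⟩ : ∃ j, m = p + 2 + j := ⟨m - (p + 2), by omega⟩
  have hmem (n : ℕ) (hn : n < 2 * (p + 2 + j) + p) : n ∈ C ∩ D ↔
      n = p ∨ n = p + 1 ∨ n = p + 2 + j + p ∨ n = p + 2 + j + (p + 1) := by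
    rw [hI]
    constructor
    · rintro (⟨k, rfl⟩ | ⟨k, rfl⟩) <;> rcases k with _ | _ | k
      · simp
      · right; right; left; ring
      · exfalso; nlinarith [Nat.zero_le ((p + 2 + j) * k)]
      · simp
      · right; right; right; ring
      · exfalso; nlinarith [Nat.zero_le ((p + 2 + j) * k)]
    · rintro (rfl | rfl | rfl | rfl)
      exacts [Or.inl ⟨0, by ring⟩, Or.inr ⟨0, by ring⟩, Or.inl ⟨1, by ring⟩,
        Or.inr ⟨1, by ring⟩]
  have hcover (n : ℕ) : n ∈ C ∨ n ∈ D := by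
    have : n ∈ C ∪ D := hU ▸ Set.mem_univ n
    exact this
  set f : ℕ → ℤ := fun n => C.indicator 1 n - D.indicator 1 n with hf
  have hfz (n : ℕ) (h : n ∈ C ∩ D) : f n = 0 := by simp [hf, h.1, h.2]
  have hfv (n : ℕ) : f n = 1 ∨ f n = 0 ∨ f n = -1 := by
    by_cases h1 : n ∈ C <;> by_cases h2 : n ∈ D <;> simp [hf, h1, h2]
  have hf0 : f 0 = 1 := by
    have : 0 ∉ D := fun h => by
      have := (hmem 0 (by omega)).1 ⟨h0, h⟩
      omega
    simp [hf, h0, this]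
  have hsum (n : ℕ) (hn : n < 2 * (p + 2 + j) + p) :
      C.indicator (1 : ℕ → ℤ) n + D.indicator 1 n = 1 + (if n = p then 1 else 0) +
        (if n = p + 1 then 1 else 0) + (if n = p + 2 + j + p then 1 else 0) +
        (if n = p + 2 + j + (p + 1) then 1 else 0) := by
    have h1 := hmem n hn
    by_cases hC : n ∈ C <;> by_cases hD : n ∈ D
    · have := h1.1 ⟨hC, hD⟩
      simp only [hC, hD, Set.indicator_of_mem, Pi.one_apply]
      split_ifs <;> omega
    · have := mt h1.2 fun h => hD h.2
      simp only [hC, hD, Set.indicator_of_mem, Pi.one_apply, not_false_eq_true,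
        Set.indicator_of_notMem]
      split_ifs <;> omega
    · have := mt h1.2 fun h => hC h.1
      simp only [hC, hD, Set.indicator_of_mem, Pi.one_apply, not_false_eq_true,
        Set.indicator_of_notMem]
      split_ifs <;> omega
    · exact absurd (hcover n) (by tauto)
  have hconv (n : ℕ) (hn : n < 2 * (p + 2 + j) + p) :
      ∑ i ∈ Finset.range (n + 1), f i + (if p ≤ n then f (n - p) else 0) +
        (if p + 1 ≤ n then f (n - (p + 1)) else 0) +
        (if p + 2 + j + p ≤ n then f (n - (p + 2 + j + p)) else 0) +
        (if p + 2 + j + (p + 1) ≤ n then f (n - (p + 2 + j + (p + 1))) else 0) =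
      if n % 2 = 0 then f (n / 2) else 0 := by
    have hcongr : ∀ x ∈ Finset.HasAntidiagonal.antidiagonal n, _ = _ := fun x hx =>
      congrArg (f x.1 * ·) (hsum x.2 (by rw [Finset.HasAntidiagonal.mem_antidiagonal] at hx; omega))
    rw [← sum_antidiagonal_sub_mul_add C D n (hR n), Finset.sum_congr rfl hcongr]
    simp only [mul_add, Finset.sum_add_distrib, mul_one]
    simp only [sum_antidiagonal_mul_ite]
    rw [Finset.Nat.sum_antidiagonal_eq_sum_range_succ_mk]
  have hrec (n : ℕ) (hn : n + 1 < 2 * (p + 2 + j) + p) :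
      f (n + 1) = dilate f (n + 1) + (if p ≤ n then f (n - p) else 0) +
        (if p + 1 ≤ n then f (n - (p + 1)) else 0) +
        (if p + 2 + j + p ≤ n then f (n - (p + 2 + j + p)) else 0) +
        (if p + 2 + j + (p + 1) ≤ n then f (n - (p + 2 + j + (p + 1))) else 0) -
        (if p ≤ n + 1 then f (n + 1 - p) else 0) -
        (if p + 1 ≤ n + 1 then f (n + 1 - (p + 1)) else 0) -
        (if p + 2 + j + p ≤ n + 1 then f (n + 1 - (p + 2 + j + p)) else 0) -
        (if p + 2 + j + (p + 1) ≤ n + 1 then f (n + 1 - (p + 2 + j + (p + 1))) else 0) := by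
    have h1 := hconv n (by omega)
    have h2 := hconv (n + 1) hn
    rw [Finset.sum_range_succ] at h2
    have h3 : dilate f (n + 1) = (if (n + 1) % 2 = 0 then f ((n + 1) / 2) else 0) -
        (if n % 2 = 0 then f (n / 2) else 0) := by
      rw [dilate]
      rcases Nat.mod_two_eq_zero_or_one n with h | h
      · rw [if_neg (by omega), if_neg (by omega), if_pos h, show (n + 1) / 2 = n / 2 by omega]
        ring
      · rw [if_pos (by omega), if_pos (by omega), if_neg (by omega)]
        ring
    linarith
  clear_value f
  refine recurrence_false f l p j hl hp (by omega) hf0 (hfz _ ((hmem _ (by omega)).2 (by tauto)))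
    (hfz _ ((hmem _ (by omega)).2 (by tauto))) hfv ?_ ?_ ?_ ?_ ?_
  · intro n h1 h2
    obtain ⟨n, rfl⟩ : ∃ x, n = x + 1 := ⟨n - 1, by omega⟩
    have := hrec n (by omega)
    repeat rw [if_neg (by omega)] at this
    linarith
  · intro i hi
    have := hrec (p + 1 + i) (by omega)
    rw [if_pos (by omega), if_pos (by omega), if_neg (by omega), if_neg (by omega),
      if_pos (by omega), if_pos (by omega), if_neg (by omega), if_neg (by omega),
      show p + 1 + i - p = i + 1 by omega, show p + 1 + i - (p + 1) = i by omega,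
      show p + 1 + i + 1 - p = i + 2 by omega, show p + 1 + i + 1 - (p + 1) = i + 1 by omega,
      show p + 1 + i + 1 = p + 2 + i by omega] at this
    linarith
  · have := hrec (p + 1 + j + p) (by omega)
    rw [if_pos (by omega), if_pos (by omega), if_neg (by omega), if_neg (by omega),
      if_pos (by omega), if_pos (by omega), if_pos (by omega), if_neg (by omega),
      show p + 1 + j + p - p = p + 1 + j by omega, show p + 1 + j + p - (p + 1) = p + j by omega,
      show p + 1 + j + p + 1 - p = p + 2 + j by omega,
      show p + 1 + j + p + 1 - (p + 1) = p + 1 + j by omega,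
      show p + 1 + j + p + 1 - (p + 2 + j + p) = 0 by omega,
      show p + 1 + j + p + 1 = p + 2 + j + p by omega] at this
    rw [hfz _ ((hmem _ (by omega)).2 (by tauto))] at this
    rw [show 2 * (p + 1) + j = p + 2 + j + p by ring]
    linarith
  · have := hrec (p + 2 + j + p) (by omega)
    rw [if_pos (by omega), if_pos (by omega), if_pos (by omega), if_neg (by omega),
      if_pos (by omega), if_pos (by omega), if_pos (by omega), if_pos (by omega),
      show p + 2 + j + p - p = p + 2 + j by omega,
      show p + 2 + j + p - (p + 1) = p + 1 + j by omega,
      show p + 2 + j + p - (p + 2 + j + p) = 0 by omega,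
      show p + 2 + j + p + 1 - p = p + 2 + (j + 1) by omega,
      show p + 2 + j + p + 1 - (p + 1) = p + 2 + j by omega,
      show p + 2 + j + p + 1 - (p + 2 + j + p) = 1 by omega,
      show p + 2 + j + p + 1 - (p + 2 + j + (p + 1)) = 0 by omega] at this
    rw [hfz _ ((hmem _ (by omega)).2 (by omega))] at this
    rw [show 2 * (p + 1) + (j + 1) = p + 2 + j + p + 1 by ring]
    linarith
  · intro k hk
    have := hrec (2 * p + 3 + (j + k)) (by omega)
    rw [if_pos (by omega), if_pos (by omega), if_pos (by omega), if_pos (by omega),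
      if_pos (by omega), if_pos (by omega), if_pos (by omega), if_pos (by omega),
      show 2 * p + 3 + (j + k) - p = p + 2 + (j + k + 1) by omega,
      show 2 * p + 3 + (j + k) - (p + 1) = p + 2 + (j + k) by omega,
      show 2 * p + 3 + (j + k) - (p + 2 + j + p) = k + 1 by omega,
      show 2 * p + 3 + (j + k) - (p + 2 + j + (p + 1)) = k by omega,
      show 2 * p + 3 + (j + k) + 1 - p = p + 2 + (j + k + 2) by omega,
      show 2 * p + 3 + (j + k) + 1 - (p + 1) = p + 2 + (j + k + 1) by omega,
      show 2 * p + 3 + (j + k) + 1 - (p + 2 + j + p) = k + 2 by omega,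
      show 2 * p + 3 + (j + k) + 1 - (p + 2 + j + (p + 1)) = k + 1 by omega,
      show 2 * p + 3 + (j + k) + 1 = 2 * (p + 2) + (j + k) by omega] at this
    linarith
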